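/- arXiv:2511.23363 — 2 statements merged into one kernel-verified Lean document; each statement's English description precedes it below -/
import Mathlib

section
/- Let (G,+) and (H,⊕) be finite groups, let k ≥ 1, let f : G → H be a function, and let μ be the fraction of tuples (σ,x) ∈ {+1,−1}^{2k} × G^{2k} for which ⊕_{i=1}^{2k} σ_i f(x_i) ≠ f(Σ_{i=1}^{2k} σ_i x_i). Suppose μ < 1/10 and g : G → H is a function such that for every a ∈ G and every h ∈ H, the number of tuples in F_a whose vote equals g(a) is at least the number of tuples in F_a whose vote equals h (g is a plurality corrector for f). Then dist(f,g) ≤ 2μ. -/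
/-- Apply a sign to a group element: `true` is `+` (identity), `false` is `-` (inverse). -/
def applySign {G : Type*} [Group G] (b : Bool) (g : G) : G := if b then g else g⁻¹

/-- Signed product `σ₁x₁ ⋯ σₖxₖ`, taken in increasing index order. -/
def sProd {G : Type*} [Group G] {k : ℕ} (σ : Fin k → Bool) (x : Fin k → G) : G :=
  (List.ofFn fun i => applySign (σ i) (x i)).prod

/-- Relative Hamming distance between two functions on a finite domain. -/
noncomputable def hdist {G H : Type*} [Fintype G] (f g : G → H) : ℝ :=
  (Nat.card {x : G // f x ≠ g x} : ℝ) / (Fintype.card G : ℝ)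

/-- Distance from `f` to the set of group homomorphisms `G →* H`. -/
noncomputable def epsF {G H : Type*} [Fintype G] [Group G] [Group H] (f : G → H) : ℝ :=
  sInf (Set.range fun h : G →* H => hdist f ⇑h)

theorem applySign_applySign {G : Type*} [Group G] (b : Bool) (x : G) :
    applySign b (applySign b x) = x := by
  cases b <;> simp [applySign]

theorem sProd_succ {G : Type*} [Group G] {n : ℕ} (σ : Fin (n + 1) → Bool) (x : Fin (n + 1) → G) :
    sProd σ x = applySign (σ 0) (x 0) * sProd (fun i => σ i.succ) (fun i => x i.succ) := by
  simp [sProd, List.ofFn_succ]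

/-- Left translation of the first signed factor of a signed product. -/
def translateFirst {G : Type*} [Group G] {n : ℕ} (c : G)
    (p : (Fin (n + 1) → Bool) × (Fin (n + 1) → G)) :
    (Fin (n + 1) → Bool) × (Fin (n + 1) → G) :=
  (p.1, Fin.cons (applySign (p.1 0) (c * applySign (p.1 0) (p.2 0))) fun i => p.2 i.succ)

theorem sProd_translateFirst {G : Type*} [Group G] {n : ℕ} (c : G)
    (p : (Fin (n + 1) → Bool) × (Fin (n + 1) → G)) :
    sProd (translateFirst c p).1 (translateFirst c p).2 = c * sProd p.1 p.2 := by
  simp [sProd_succ, translateFirst, applySign_applySign, mul_assoc]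

theorem translateFirst_inv_translateFirst {G : Type*} [Group G] {n : ℕ} (c : G)
    (p : (Fin (n + 1) → Bool) × (Fin (n + 1) → G)) :
    translateFirst c⁻¹ (translateFirst c p) = p := by
  refine Prod.ext rfl (funext fun i => ?_)
  refine Fin.cases ?_ (fun j => ?_) i <;> simp [translateFirst, applySign_applySign]

/-- All fibers of the signed product of at least one factor have the same size. -/
theorem card_sProd_fiber_le {G : Type*} [Group G] [Fintype G] [DecidableEq G] {m : ℕ} (hm : 0 < m)
    (a b : G) :
    (Finset.univ.filter fun p : (Fin m → Bool) × (Fin m → G) => sProd p.1 p.2 = a).card ≤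
      (Finset.univ.filter fun p : (Fin m → Bool) × (Fin m → G) => sProd p.1 p.2 = b).card := by
  obtain ⟨n, rfl⟩ : ∃ n, m = n + 1 := ⟨m - 1, by omega⟩
  refine Finset.card_le_card_of_injOn (translateFirst (b * a⁻¹)) (fun p hp => ?_) ?_
  · simp only [Finset.coe_filter, Finset.mem_univ, true_and, Set.mem_ofPred_eq] at hp ⊢
    rw [sProd_translateFirst, hp, inv_mul_cancel_right]
  · exact (Function.LeftInverse.injective (translateFirst_inv_translateFirst _)).injOn

/-- If `s : P → G` has fibers of equal size `N` and `g a` is a most frequent value of `v` on the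
fiber over `a`, then each `a` with `f a ≠ g a` forces `v ≠ f ∘ s` on half of its fiber. -/
theorem card_ne_mul_le_of_plurality {P G H : Type*} [Fintype P] [Fintype G] [DecidableEq G]
    [DecidableEq H] (s : P → G) (v : P → H) (f g : G → H) (N : ℕ)
    (hN : ∀ a, (Finset.univ.filter fun p => s p = a).card = N)
    (hplur : ∀ a h, (Finset.univ.filter fun p => s p = a ∧ v p = h).card ≤
      (Finset.univ.filter fun p => s p = a ∧ v p = g a).card) :
    (Finset.univ.filter fun a => f a ≠ g a).card * N ≤
      2 * (Finset.univ.filter fun p => v p ≠ f (s p)).card := by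
  have hfiber : ∀ a ∈ Finset.univ.filter (fun a => f a ≠ g a),
      N ≤ 2 * (Finset.univ.filter fun p => s p = a ∧ v p ≠ f a).card := by
    intro a ha
    have hne : f a ≠ g a := by simpa using ha
    have hsplit := Finset.card_filter_add_card_filter_not
      (s := Finset.univ.filter fun p => s p = a) (fun p => v p = f a)
    rw [Finset.filter_filter, Finset.filter_filter, hN] at hsplit
    have hle : (Finset.univ.filter fun p => s p = a ∧ v p = g a).card ≤
        (Finset.univ.filter fun p => s p = a ∧ v p ≠ f a).card := by
      refine Finset.card_le_card fun p hp => ?_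
      simp only [Finset.mem_filter, Finset.mem_univ, true_and] at hp ⊢
      exact ⟨hp.1, fun h => hne (h.symm.trans hp.2)⟩
    have := hplur a (f a)
    simp only [ne_eq] at hle ⊢
    omega
  have hsum : ∑ a, (Finset.univ.filter fun p => s p = a ∧ v p ≠ f a).card =
      (Finset.univ.filter fun p => v p ≠ f (s p)).card := by
    rw [Finset.card_eq_sum_card_fiberwise (f := s) (t := Finset.univ) (by simp)]
    refine Finset.sum_congr rfl fun a _ => congrArg Finset.card ?_
    ext p
    simp only [Finset.mem_filter, Finset.mem_univ, true_and]
    constructor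
    · rintro ⟨rfl, h⟩
      exact ⟨h, rfl⟩
    · rintro ⟨h, rfl⟩
      exact ⟨rfl, h⟩
  rw [← hsum, Finset.mul_sum]
  calc (Finset.univ.filter fun a => f a ≠ g a).card * N
      ≤ ∑ a ∈ Finset.univ.filter (fun a => f a ≠ g a),
          2 * (Finset.univ.filter fun p => s p = a ∧ v p ≠ f a).card := by
        simpa using Finset.card_nsmul_le_sum _ _ N hfiber
    _ ≤ _ := Finset.sum_le_sum_of_subset (Finset.subset_univ _)

theorem stmt8 {G H : Type*} [Group G] [Group H] [Fintype G] [Fintype H]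
    (k : ℕ) (hk : 1 ≤ k) (f : G → H) (μ : ℝ)
    (hμ : μ = (Nat.card {p : (Fin (2 * k) → Bool) × (Fin (2 * k) → G) //
          sProd p.1 (fun i => f (p.2 i)) ≠ f (sProd p.1 p.2)} : ℝ) /
        (Nat.card ((Fin (2 * k) → Bool) × (Fin (2 * k) → G)) : ℝ))
    (hsmall : μ < 1 / 10) (g : G → H)
    (hplur : ∀ (a : G) (h : H),
      Nat.card {p : (Fin (2 * k) → Bool) × (Fin (2 * k) → G) //
          sProd p.1 p.2 = a ∧ sProd p.1 (fun i => f (p.2 i)) = h} ≤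
        Nat.card {p : (Fin (2 * k) → Bool) × (Fin (2 * k) → G) //
          sProd p.1 p.2 = a ∧ sProd p.1 (fun i => f (p.2 i)) = g a}) :
    hdist f g ≤ 2 * μ := by
  classical
  simp only [Nat.card_eq_fintype_card, Fintype.card_subtype] at hμ hplur
  set N := (Finset.univ.filter fun p : (Fin (2 * k) → Bool) × (Fin (2 * k) → G) =>
    sProd p.1 p.2 = 1).card with hNdef
  have hN : ∀ a : G, (Finset.univ.filter fun p : (Fin (2 * k) → Bool) × (Fin (2 * k) → G) =>
      sProd p.1 p.2 = a).card = N := fun a =>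
    le_antisymm (card_sProd_fiber_le (by omega) a 1) (card_sProd_fiber_le (by omega) 1 a)
  have htotal : Fintype.card ((Fin (2 * k) → Bool) × (Fin (2 * k) → G)) =
      Fintype.card G * N := by
    rw [← Finset.card_univ, Finset.card_eq_sum_card_fiberwise
      (f := fun p : (Fin (2 * k) → Bool) × (Fin (2 * k) → G) => sProd p.1 p.2)
      (t := Finset.univ) (by simp)]
    simp [hN]
  have hcount := card_ne_mul_le_of_plurality
    (fun p : (Fin (2 * k) → Bool) × (Fin (2 * k) → G) => sProd p.1 p.2)
    (fun p => sProd p.1 fun i => f (p.2 i)) f g N hN hplur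
  have hG : (0 : ℝ) < Fintype.card G := by exact_mod_cast Fintype.card_pos
  have hNpos : (0 : ℝ) < N := by
    have h : 0 < Fintype.card G * N := htotal ▸ Fintype.card_pos
    exact_mod_cast Nat.pos_of_mul_pos_left h
  rw [hμ, htotal, hdist, Nat.card_eq_fintype_card, Fintype.card_subtype, ← mul_div_assoc,
    div_le_div_iff₀ hG (by push_cast; positivity)]
  have hcast := mul_le_mul_of_nonneg_right (Nat.cast_le (α := ℝ).2 hcount) hG.le
  push_cast at hcast ⊢
  linarith
end

section
/- Let (G,+) be a finite group and let m ≥ 2 be even with 2^m ≤ |G|^{1/4}. Then the fraction of tuples X = (x_1,…,x_m) ∈ G^m for which there exists z ∈ G such that the number of pairs (σ, S), with σ ∈ {+1,−1}^m and S ⊆ {1,…,m} of size |S| = m/2, satisfying Σ_{j∈S} σ_j x_j = z exceeds 2^m, is at most 1/2^m. Equivalently, for all but a 1/2^m fraction of X ∈ G^m, the distribution of y = Σ_{j∈S} σ_j x_j, where σ is uniform over {+1,−1}^m and S is uniform over the size-m/2 subsets of {1,…,m}, assigns probability at most 1/binom(m, m/2) to every element of G. -/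
/-- Partial signed product over a subset `S` of the indices, in increasing index order. -/
def sProdOn {G : Type*} [Group G] {m : ℕ} (S : Finset (Fin m))
    (σ : Fin m → Bool) (x : Fin m → G) : G :=
  ((S.sort (· ≤ ·)).map fun i => applySign (σ i) (x i)).prod

theorem applySign_injective {G : Type*} [Group G] (b : Bool) :
    Function.Injective (applySign b : G → G) := by
  intro g h hgh
  cases b <;> simpa [applySign] using hgh

/-- A signed product does not depend on the values at indices outside its index set. -/
theorem sProdOn_congr {G : Type*} [Group G] {m : ℕ} {S : Finset (Fin m)} (σ : Fin m → Bool)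
    {X Y : Fin m → G} (h : ∀ i ∈ S, X i = Y i) : sProdOn S σ X = sProdOn S σ Y := by
  unfold sProdOn
  congr 1
  refine List.map_congr_left fun i hi => ?_
  rw [h i (by simpa using hi)]

/-- A signed product determines the value at any one of its indices, given the other values. -/
theorem eq_of_sProdOn_eq {G : Type*} [Group G] {m : ℕ} {S : Finset (Fin m)} {σ : Fin m → Bool}
    {X Y : Fin m → G} {j : Fin m} (hj : j ∈ S) (h : ∀ i, i ≠ j → X i = Y i)
    (hS : sProdOn S σ X = sProdOn S σ Y) : X j = Y j := by
  obtain ⟨l₁, l₂, hl⟩ := List.append_of_mem ((Finset.mem_sort (· ≤ ·)).2 hj)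
  have hnd : (l₁ ++ j :: l₂).Nodup := hl ▸ Finset.sort_nodup S (· ≤ ·)
  rw [List.nodup_middle, List.nodup_cons, List.mem_append, not_or] at hnd
  have map_eq : ∀ l : List (Fin m), j ∉ l →
      l.map (fun i => applySign (σ i) (X i)) = l.map (fun i => applySign (σ i) (Y i)) := by
    intro l hjl
    refine List.map_congr_left fun i hi => ?_
    rw [h i (ne_of_mem_of_not_mem hi hjl)]
  unfold sProdOn at hS
  rw [hl] at hS
  simp only [List.map_append, List.map_cons, List.prod_append, List.prod_cons,
    map_eq l₁ hnd.1.1, map_eq l₂ hnd.1.2, mul_right_inj, mul_left_inj] at hS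
  exact applySign_injective _ hS

/-- Signed products over two index sets, the first not contained in the second, agree on at most
a `1 / |G|` fraction of all tuples. -/
theorem ncard_sProdOn_eq_le {G : Type*} [Group G] [Fintype G] {m : ℕ} (σ : Fin m → Bool)
    {S T : Finset (Fin m)} (hST : ¬ S ⊆ T) :
    {X : Fin m → G | sProdOn S σ X = sProdOn T σ X}.ncard ≤ Fintype.card G ^ (m - 1) := by
  classical
  obtain ⟨j, hjS, hjT⟩ := Finset.not_subset.1 hST
  have hcard : Nat.card ({i : Fin m // i ≠ j} → G) = Fintype.card G ^ (m - 1) := by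
    simp
  rw [← hcard, ← Set.ncard_univ]
  refine Set.ncard_le_ncard_of_injOn (fun X i => X i.1) (fun _ _ => Set.mem_univ _) ?_
  intro X hX Y hY hXY
  have off : ∀ i, i ≠ j → X i = Y i := fun i hi => congrFun hXY ⟨i, hi⟩
  have hT : sProdOn T σ X = sProdOn T σ Y :=
    sProdOn_congr σ fun i hi => off i (ne_of_mem_of_not_mem hi hjT)
  have hj : X j = Y j := eq_of_sProdOn_eq hjS off (hX.trans (hT.trans hY.symm))
  funext i
  by_cases hi : i = j
  · exact hi ▸ hj
  · exact off i hi

/-- If some element has more than `2 ^ m` representations, then two of them share their signs. -/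
theorem exists_sProdOn_eq_of_lt_card {G : Type*} [Group G] {m k : ℕ} {X : Fin m → G} {z : G}
    (h : 2 ^ m < Nat.card {p : (Fin m → Bool) × Finset (Fin m) //
      p.2.card = k ∧ sProdOn p.2 p.1 X = z}) :
    ∃ (σ : Fin m → Bool) (S T : Finset (Fin m)), ¬ S ⊆ T ∧ sProdOn S σ X = sProdOn T σ X := by
  have hninj : ¬ Function.Injective (fun p : {p : (Fin m → Bool) × Finset (Fin m) //
      p.2.card = k ∧ sProdOn p.2 p.1 X = z} => p.1.1) := by
    intro hinj
    have := Nat.card_le_card_of_injective _ hinj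
    simp only [Nat.card_eq_fintype_card (α := Fin m → Bool), Fintype.card_fun,
      Fintype.card_bool, Fintype.card_fin] at this
    omega
  rw [Function.not_injective_iff] at hninj
  obtain ⟨⟨⟨σ, S⟩, hS, hSz⟩, ⟨⟨τ, T⟩, hT, hTz⟩, hστ, hne⟩ := hninj
  obtain rfl : σ = τ := hστ
  refine ⟨σ, S, T, fun hST => hne ?_, hSz.trans hTz.symm⟩
  obtain rfl : S = T := Finset.eq_of_subset_of_card_le hST (hT.trans hS.symm).le
  rfl

theorem stmt15 {G : Type*} [Group G] [Fintype G] (m : ℕ) (hm : 2 ≤ m) (hme : Even m)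
    (hGm : (2 : ℝ) ^ m ≤ (Fintype.card G : ℝ) ^ ((1 : ℝ) / 4)) :
    (Nat.card {X : Fin m → G // ∃ z : G,
        2 ^ m < Nat.card {p : (Fin m → Bool) × Finset (Fin m) //
          p.2.card = m / 2 ∧ sProdOn p.2 p.1 X = z}} : ℝ) /
      (Nat.card (Fin m → G) : ℝ) ≤ 1 / 2 ^ m := by
  have hG : (2 : ℝ) ^ m * 2 ^ m * 2 ^ m * 2 ^ m ≤ Fintype.card G := by
    have h4 := pow_le_pow_left₀ (by positivity) hGm 4
    rw [← Real.rpow_natCast ((Fintype.card G : ℝ) ^ ((1 : ℝ) / 4)) 4,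
      ← Real.rpow_mul (Nat.cast_nonneg _)] at h4
    norm_num at h4
    linarith
  have hbad : Nat.card {X : Fin m → G // ∃ z : G,
      2 ^ m < Nat.card {p : (Fin m → Bool) × Finset (Fin m) //
        p.2.card = m / 2 ∧ sProdOn p.2 p.1 X = z}} ≤
      2 ^ m * 2 ^ m * 2 ^ m * Fintype.card G ^ (m - 1) := by
    let E : (Fin m → Bool) × Finset (Fin m) × Finset (Fin m) → Set (Fin m → G) :=
      fun t => {X | ¬ t.2.1 ⊆ t.2.2 ∧ sProdOn t.2.1 t.1 X = sProdOn t.2.2 t.1 X}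
    have hE : ∀ t, (E t).ncard ≤ Fintype.card G ^ (m - 1) := by
      rintro ⟨σ, S, T⟩
      by_cases hST : S ⊆ T
      · simp [E, hST]
      · simpa [E, hST] using ncard_sProdOn_eq_le (G := G) σ hST
    calc _ ≤ (⋃ t, E t).ncard := by
          refine Set.ncard_le_ncard (s := {X : Fin m → G | _}) ?_
          rintro X ⟨z, hz⟩
          obtain ⟨σ, S, T, h⟩ := exists_sProdOn_eq_of_lt_card hz
          exact Set.mem_iUnion.2 ⟨(σ, S, T), h⟩
      _ ≤ ∑ t, (E t).ncard := Set.ncard_iUnion_le_of_fintype E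
      _ ≤ ∑ _t : (Fin m → Bool) × Finset (Fin m) × Finset (Fin m),
          Fintype.card G ^ (m - 1) := Finset.sum_le_sum fun t _ => hE t
      _ = _ := by simp [mul_assoc]
  have hcard : (Nat.card (Fin m → G) : ℝ) = Fintype.card G * Fintype.card G ^ (m - 1) := by
    rw [← pow_succ', Nat.sub_add_cancel (by omega)]
    simp
  have hpos : (0 : ℝ) < Fintype.card G := by exact_mod_cast Fintype.card_pos
  rw [hcard, div_le_div_iff₀ (by positivity) (by positivity), one_mul]
  calc _ ≤ ((2 ^ m * 2 ^ m * 2 ^ m * Fintype.card G ^ (m - 1) : ℕ) : ℝ) * 2 ^ m := by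
        gcongr
    _ = 2 ^ m * 2 ^ m * 2 ^ m * 2 ^ m * (Fintype.card G : ℝ) ^ (m - 1) := by
        push_cast
        ring
    _ ≤ _ := by gcongr
end
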